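/- Let (A, μ, Δ = [−,r]_*, α, r) be a coboundary infinitesimal Hom-bialgebra with r anti-symmetric (i.e., τ(r) = −r). Then A_{HLie} = (A, [−,−], δ, α, r) is a coboundary Hom-Lie bialgebra, where [x,y] = μ(x,y) − μ(y,x) and δ = (Id − τ)∘Δ; in particular δ(a) = ad_a(r) for all a ∈ A, and the balanceator of A is identically zero. -/

import Mathlib

open TensorProduct

noncomputable section

variable {k : Type*} [Field k] {A : Type*} [AddCommGroup A] [Module k A]

/-- `(A, μ, α)` is a Hom-associative algebra: multiplicativity and Hom-associativity. -/
def IsHomAssociative (μ : A ⊗[k] A →ₗ[k] A) (α : A →ₗ[k] A) : Prop :=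
  (∀ x y : A, α (μ (x ⊗ₜ y)) = μ (α x ⊗ₜ α y)) ∧
  (∀ x y z : A, μ (α x ⊗ₜ μ (y ⊗ₜ z)) = μ (μ (x ⊗ₜ y) ⊗ₜ α z))

/-- `(A, Δ, α)` is a Hom-coassociative coalgebra: comultiplicativity and
Hom-coassociativity (the latter via the associator). -/
def IsHomCoassociative (Δ : A →ₗ[k] A ⊗[k] A) (α : A →ₗ[k] A) : Prop :=
  (∀ a : A, Δ (α a) = TensorProduct.map α α (Δ a)) ∧
  (∀ a : A, TensorProduct.map α Δ (Δ a)
      = TensorProduct.assoc k A A A (TensorProduct.map Δ α (Δ a)))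

/-- The cocycle condition `Δ∘μ = (μ⊗α)∘(α⊗Δ) + (α⊗μ)∘(Δ⊗α)`. -/
def IsCocycle (μ : A ⊗[k] A →ₗ[k] A) (Δ : A →ₗ[k] A ⊗[k] A) (α : A →ₗ[k] A) : Prop :=
  ∀ a b : A,
    Δ (μ (a ⊗ₜ b)) =
      TensorProduct.map μ α ((TensorProduct.assoc k A A A).symm (α a ⊗ₜ Δ b)) +
      TensorProduct.map α μ (TensorProduct.assoc k A A A (Δ a ⊗ₜ α b))

/-- Infinitesimal Hom-bialgebra. -/
def IsInfHomBialgebra (μ : A ⊗[k] A →ₗ[k] A) (Δ : A →ₗ[k] A ⊗[k] A)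
    (α : A →ₗ[k] A) : Prop :=
  IsHomAssociative μ α ∧ IsHomCoassociative Δ α ∧ IsCocycle μ Δ α

/-- `[a, -]_*` : sends `Σ b₁⊗b₂` to `Σ μ(a,b₁)⊗α(b₂) − α(b₁)⊗μ(b₂,a)`. -/
def starBracket (μ : A ⊗[k] A →ₗ[k] A) (α : A →ₗ[k] A) (a : A) :
    A ⊗[k] A →ₗ[k] A ⊗[k] A :=
  TensorProduct.map (μ ∘ₗ TensorProduct.mk k A A a) α
    - TensorProduct.map α (μ ∘ₗ (TensorProduct.mk k A A).flip a)

/-- Coboundary infinitesimal Hom-bialgebra: an infinitesimal Hom-bialgebra with an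
`α`-invariant `r` such that `Δ = [-, r]_*`. -/
def IsCoboundary (μ : A ⊗[k] A →ₗ[k] A) (Δ : A →ₗ[k] A ⊗[k] A) (α : A →ₗ[k] A)
    (r : A ⊗[k] A) : Prop :=
  IsInfHomBialgebra μ Δ α ∧ TensorProduct.map α α r = r ∧
    ∀ a : A, Δ a = starBracket μ α a r

/-- `[a, -]_•` on 2-tensors: `Σ μ(α(a),b₁)⊗α(b₂) − α(b₁)⊗μ(b₂,α(a))`. -/
def dotBracket2 (μ : A ⊗[k] A →ₗ[k] A) (α : A →ₗ[k] A) (a : A) :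
    A ⊗[k] A →ₗ[k] A ⊗[k] A :=
  TensorProduct.map (μ ∘ₗ TensorProduct.mk k A A (α a)) α
    - TensorProduct.map α (μ ∘ₗ (TensorProduct.mk k A A).flip (α a))

/-- `[a, -]_•` on 3-tensors: `Σ μ(α(a),b₁)⊗α(b₂)⊗α(b₃) − α(b₁)⊗α(b₂)⊗μ(b₃,α(a))`. -/
def dotBracket3 (μ : A ⊗[k] A →ₗ[k] A) (α : A →ₗ[k] A) (a : A) :
    A ⊗[k] (A ⊗[k] A) →ₗ[k] A ⊗[k] (A ⊗[k] A) :=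
  TensorProduct.map (μ ∘ₗ TensorProduct.mk k A A (α a)) (TensorProduct.map α α)
    - TensorProduct.map α
        (TensorProduct.map α (μ ∘ₗ (TensorProduct.mk k A A).flip (α a)))

/-- `(r, s) ↦ r₁₃s₁₂ = Σ μ(uᵢ,uⱼ')⊗α(vⱼ')⊗α(vᵢ)` for `r = Σ uᵢ⊗vᵢ`, `s = Σ uⱼ'⊗vⱼ'`. -/
def t13_12 (μ : A ⊗[k] A →ₗ[k] A) (α : A →ₗ[k] A) :
    (A ⊗[k] A) ⊗[k] (A ⊗[k] A) →ₗ[k] A ⊗[k] (A ⊗[k] A) :=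
  TensorProduct.map μ
      (TensorProduct.map α α ∘ₗ (TensorProduct.comm k A A).toLinearMap)
    ∘ₗ (TensorProduct.tensorTensorTensorComm k A A A A).toLinearMap

/-- `(r, s) ↦ r₁₂s₂₃ = Σ α(uᵢ)⊗μ(vᵢ,uⱼ')⊗α(vⱼ')`. -/
def t12_23 (μ : A ⊗[k] A →ₗ[k] A) (α : A →ₗ[k] A) :
    (A ⊗[k] A) ⊗[k] (A ⊗[k] A) →ₗ[k] A ⊗[k] (A ⊗[k] A) :=
  TensorProduct.map α
      (TensorProduct.map μ α ∘ₗ (TensorProduct.assoc k A A A).symm.toLinearMap)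
    ∘ₗ (TensorProduct.assoc k A A (A ⊗[k] A)).toLinearMap

/-- `(r, s) ↦ r₂₃s₁₃ = Σ α(uⱼ')⊗α(uᵢ)⊗μ(vᵢ,vⱼ')`. -/
def t23_13 (μ : A ⊗[k] A →ₗ[k] A) (α : A →ₗ[k] A) :
    (A ⊗[k] A) ⊗[k] (A ⊗[k] A) →ₗ[k] A ⊗[k] (A ⊗[k] A) :=
  (TensorProduct.assoc k A A A).toLinearMap
    ∘ₗ TensorProduct.map
        (TensorProduct.map α α ∘ₗ (TensorProduct.comm k A A).toLinearMap) μ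
    ∘ₗ (TensorProduct.tensorTensorTensorComm k A A A A).toLinearMap

/-- `A(r) = r₁₃r₁₂ − r₁₂r₂₃ + r₂₃r₁₃`. -/
def Atensor (μ : A ⊗[k] A →ₗ[k] A) (α : A →ₗ[k] A) (r : A ⊗[k] A) :
    A ⊗[k] (A ⊗[k] A) :=
  t13_12 μ α (r ⊗ₜ r) - t12_23 μ α (r ⊗ₜ r) + t23_13 μ α (r ⊗ₜ r)

/-- Quasi-triangular infinitesimal Hom-bialgebra: coboundary with `A(r) = 0`. -/
def IsQuasiTriangular (μ : A ⊗[k] A →ₗ[k] A) (Δ : A →ₗ[k] A ⊗[k] A) (α : A →ₗ[k] A)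
    (r : A ⊗[k] A) : Prop :=
  IsCoboundary μ Δ α r ∧ Atensor μ α r = 0

/-- The balanceator `B(x,y) = [x, Δᵒᵖ(y)]_• + τ([y, Δᵒᵖ(x)]_•)`. -/
def balanceator (μ : A ⊗[k] A →ₗ[k] A) (Δ : A →ₗ[k] A ⊗[k] A) (α : A →ₗ[k] A)
    (x y : A) : A ⊗[k] A :=
  dotBracket2 μ α x (TensorProduct.comm k A A (Δ y))
    + TensorProduct.comm k A A (dotBracket2 μ α y (TensorProduct.comm k A A (Δ x)))

/-- `ad_x` on 2-tensors, for a bilinear bracket `br`: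
`y₁⊗y₂ ↦ [x,y₁]⊗α(y₂) + α(y₁)⊗[x,y₂]`. -/
def adMap (br : A →ₗ[k] A →ₗ[k] A) (α : A →ₗ[k] A) (x : A) :
    A ⊗[k] A →ₗ[k] A ⊗[k] A :=
  TensorProduct.map (br x) α + TensorProduct.map α (br x)

/-- Cyclic rotation on triple tensors: `x⊗y⊗z ↦ y⊗z⊗x`. -/
def cyc3 : A ⊗[k] (A ⊗[k] A) →ₗ[k] A ⊗[k] (A ⊗[k] A) :=
  (TensorProduct.assoc k A A A).toLinearMap
    ∘ₗ (TensorProduct.comm k A (A ⊗[k] A)).toLinearMap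

/-- Hom-Lie bialgebra: Hom-Lie algebra, Hom-Lie coalgebra, and the cocycle
compatibility `δ([x,y]) = ad_{α(x)}(δ(y)) − ad_{α(y)}(δ(x))`. -/
def IsHomLieBialgebra (br : A →ₗ[k] A →ₗ[k] A) (δ : A →ₗ[k] A ⊗[k] A)
    (α : A →ₗ[k] A) : Prop :=
  (∀ x y : A, br x y = - br y x) ∧
  (∀ x y : A, α (br x y) = br (α x) (α y)) ∧
  (∀ x y z : A, br (br x y) (α z) + br (br z x) (α y) + br (br y z) (α x) = 0) ∧
  (∀ x : A, δ (α x) = TensorProduct.map α α (δ x)) ∧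
  (∀ x : A, TensorProduct.comm k A A (δ x) = - δ x) ∧
  (∀ x : A, TensorProduct.map α δ (δ x) + cyc3 (TensorProduct.map α δ (δ x))
      + cyc3 (cyc3 (TensorProduct.map α δ (δ x))) = 0) ∧
  (∀ x y : A, δ (br x y) = adMap br α (α x) (δ y) - adMap br α (α y) (δ x))

/-- The commutator bracket of `μ`, as a bilinear map. -/
def commBracket (μ : A ⊗[k] A →ₗ[k] A) : A →ₗ[k] A →ₗ[k] A :=
  TensorProduct.curry μ - (TensorProduct.curry μ).flip

/-- The cocommutator cobracket `(Id − τ)∘Δ`. -/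
def cobracket (Δ : A →ₗ[k] A ⊗[k] A) : A →ₗ[k] A ⊗[k] A :=
  Δ - (TensorProduct.comm k A A).toLinearMap ∘ₗ Δ

/-- `(r, s) ↦ [r₁₂, s₁₃] = Σ β(uᵢ⊗uⱼ')⊗α(vᵢ)⊗α(vⱼ')` for a bracket `β`. -/
def c12_13 (β : A ⊗[k] A →ₗ[k] A) (α : A →ₗ[k] A) :
    (A ⊗[k] A) ⊗[k] (A ⊗[k] A) →ₗ[k] A ⊗[k] (A ⊗[k] A) :=
  TensorProduct.map β (TensorProduct.map α α)
    ∘ₗ (TensorProduct.tensorTensorTensorComm k A A A A).toLinearMap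

/-- `(r, s) ↦ [r₁₂, s₂₃] = Σ α(uᵢ)⊗β(vᵢ⊗uⱼ')⊗α(vⱼ')`. -/
def c12_23 (β : A ⊗[k] A →ₗ[k] A) (α : A →ₗ[k] A) :
    (A ⊗[k] A) ⊗[k] (A ⊗[k] A) →ₗ[k] A ⊗[k] (A ⊗[k] A) :=
  TensorProduct.map α
      (TensorProduct.map β α ∘ₗ (TensorProduct.assoc k A A A).symm.toLinearMap)
    ∘ₗ (TensorProduct.assoc k A A (A ⊗[k] A)).toLinearMap

/-- `(r, s) ↦ [r₁₃, s₂₃] = Σ α(uᵢ)⊗α(uⱼ')⊗β(vᵢ⊗vⱼ')`. -/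
def c13_23 (β : A ⊗[k] A →ₗ[k] A) (α : A →ₗ[k] A) :
    (A ⊗[k] A) ⊗[k] (A ⊗[k] A) →ₗ[k] A ⊗[k] (A ⊗[k] A) :=
  (TensorProduct.assoc k A A A).toLinearMap
    ∘ₗ TensorProduct.map (TensorProduct.map α α) β
    ∘ₗ (TensorProduct.tensorTensorTensorComm k A A A A).toLinearMap

/-- `C(r) = [r₁₂,r₁₃] + [r₁₂,r₂₃] + [r₁₃,r₂₃]` for a bracket `β`. -/
def Ctensor (β : A ⊗[k] A →ₗ[k] A) (α : A →ₗ[k] A) (r : A ⊗[k] A) :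
    A ⊗[k] (A ⊗[k] A) :=
  c12_13 β α (r ⊗ₜ r) + c12_23 β α (r ⊗ₜ r) + c13_23 β α (r ⊗ₜ r)

@[simp]
theorem starBracket_tmul (μ : A ⊗[k] A →ₗ[k] A) (α : A →ₗ[k] A) (a u v : A) :
    starBracket μ α a (u ⊗ₜ v) = μ (a ⊗ₜ u) ⊗ₜ α v - α u ⊗ₜ μ (v ⊗ₜ a) := by
  simp [starBracket]

@[simp]
theorem dotBracket2_tmul (μ : A ⊗[k] A →ₗ[k] A) (α : A →ₗ[k] A) (a u v : A) :
    dotBracket2 μ α a (u ⊗ₜ v) = μ (α a ⊗ₜ u) ⊗ₜ α v - α u ⊗ₜ μ (v ⊗ₜ α a) := by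
  simp [dotBracket2]

@[simp]
theorem commBracket_apply (μ : A ⊗[k] A →ₗ[k] A) (x y : A) :
    commBracket μ x y = μ (x ⊗ₜ y) - μ (y ⊗ₜ x) := by
  simp [commBracket]

@[simp]
theorem adMap_tmul (br : A →ₗ[k] A →ₗ[k] A) (α : A →ₗ[k] A) (x u v : A) :
    adMap br α x (u ⊗ₜ v) = br x u ⊗ₜ α v + α u ⊗ₜ br x v := by
  simp [adMap]

theorem cyc3_tmul (x y z : A) :
    cyc3 (k := k) (x ⊗ₜ (y ⊗ₜ z)) = y ⊗ₜ (z ⊗ₜ x) := by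
  simp [cyc3]

theorem commBracket_map {μ : A ⊗[k] A →ₗ[k] A} {α : A →ₗ[k] A}
    (h : IsHomAssociative μ α) (x y : A) :
    α (commBracket μ x y) = commBracket μ (α x) (α y) := by
  simp [h.1]

theorem commBracket_jacobi {μ : A ⊗[k] A →ₗ[k] A} {α : A →ₗ[k] A}
    (h : IsHomAssociative μ α) (x y z : A) :
    commBracket μ (commBracket μ x y) (α z) + commBracket μ (commBracket μ z x) (α y)
      + commBracket μ (commBracket μ y z) (α x) = 0 := by
  simp only [commBracket_apply, map_sub, LinearMap.sub_apply, h.2]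
  abel

/-- For a Hom-Lie bracket, `ad_{α(x)} ∘ ad_y - ad_{α(y)} ∘ ad_x = ad_{[x,y]} ∘ (α ⊗ α)`. -/
theorem adMap_commutator {br : A →ₗ[k] A →ₗ[k] A} {α : A →ₗ[k] A}
    (hskew : ∀ x y : A, br x y = - br y x)
    (hα : ∀ x y : A, α (br x y) = br (α x) (α y))
    (hjac : ∀ x y z : A,
      br (br x y) (α z) + br (br z x) (α y) + br (br y z) (α x) = 0)
    (x y : A) (t : A ⊗[k] A) :
    adMap br α (α x) (adMap br α y t) - adMap br α (α y) (adMap br α x t)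
      = adMap br α (br x y) (TensorProduct.map α α t) := by
  have key (z : A) : br (br x y) (α z) = br (α x) (br y z) - br (α y) (br x z) := by
    rw [hskew (α x), hskew (α y), hskew x z, map_neg, LinearMap.neg_apply]
    linear_combination (norm := module) hjac x y z
  induction t with
  | zero => simp
  | tmul u v =>
    simp only [adMap_tmul, map_add, map_tmul, key, hα, sub_tmul, tmul_sub]
    abel
  | add s t hs ht =>
    simp only [map_add, ← hs, ← ht]
    abel

theorem starBracket_add_comm (μ : A ⊗[k] A →ₗ[k] A) (α : A →ₗ[k] A) (a : A)
    (t : A ⊗[k] A) :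
    starBracket μ α a t
        + TensorProduct.comm k A A (starBracket μ α a (TensorProduct.comm k A A t))
      = adMap (commBracket μ) α a t := by
  induction t with
  | zero => simp
  | tmul u v =>
    simp only [comm_tmul, starBracket_tmul, map_sub, adMap_tmul, commBracket_apply,
      sub_tmul, tmul_sub]
    abel
  | add s t hs ht =>
    simp only [map_add, ← hs, ← ht]
    abel

theorem dotBracket2_comm_starBracket {μ : A ⊗[k] A →ₗ[k] A} {α : A →ₗ[k] A}
    (h : IsHomAssociative μ α) (x y : A) (t : A ⊗[k] A) :
    dotBracket2 μ α x
        (TensorProduct.comm k A A (starBracket μ α y (TensorProduct.comm k A A t)))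
      = TensorProduct.comm k A A
          (dotBracket2 μ α y (TensorProduct.comm k A A (starBracket μ α x t))) := by
  induction t with
  | zero => simp
  | tmul u v =>
    simp only [comm_tmul, starBracket_tmul, map_sub, dotBracket2_tmul, h.1, h.2]
    abel
  | add s t hs ht => simp only [map_add, hs, ht]

theorem comm_cobracket (Δ : A →ₗ[k] A ⊗[k] A) (x : A) :
    TensorProduct.comm k A A (cobracket Δ x) = - cobracket Δ x := by
  have hinv (t : A ⊗[k] A) :
      TensorProduct.comm k A A (TensorProduct.comm k A A t) = t :=
    (TensorProduct.comm k A A).symm_apply_apply t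
  simp [cobracket, hinv]

theorem cobracket_map {Δ : A →ₗ[k] A ⊗[k] A} {α : A →ₗ[k] A}
    (h : IsHomCoassociative Δ α) (x : A) :
    cobracket Δ (α x) = TensorProduct.map α α (cobracket Δ x) := by
  simp [cobracket, h.1, TensorProduct.map_comm]

/-- The cyclic sum over the signed action of `1`, `(2 3)`, a rotation and a transposition
of the tensor factors vanishes. -/
theorem cyclic_sum_eq_zero (p q : A ⊗[k] (A ⊗[k] A))
    (hq : q = p - LinearMap.lTensor A (TensorProduct.comm k A A).toLinearMap p
      - (TensorProduct.comm k (A ⊗[k] A) A ((TensorProduct.assoc k A A A).symm p)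
        - LinearMap.lTensor A (TensorProduct.comm k A A).toLinearMap
          (TensorProduct.comm k (A ⊗[k] A) A ((TensorProduct.assoc k A A A).symm p)))) :
    q + cyc3 q + cyc3 (cyc3 q) = 0 := by
  subst hq
  induction p with
  | zero => simp
  | tmul a t =>
    induction t with
    | zero => simp
    | tmul b c =>
      simp only [LinearMap.lTensor_tmul, LinearEquiv.coe_coe, comm_tmul, assoc_symm_tmul,
        map_sub, cyc3_tmul]
      abel
    | add s t hs ht =>
      simp only [tmul_add, map_add, map_sub] at hs ht ⊢
      linear_combination (norm := module) hs + ht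
  | add s t hs ht =>
    simp only [map_add, map_sub] at hs ht ⊢
    linear_combination (norm := module) hs + ht

theorem cobracket_coJacobi {Δ : A →ₗ[k] A ⊗[k] A} {α : A →ₗ[k] A}
    (h : IsHomCoassociative Δ α) (x : A) :
    TensorProduct.map α (cobracket Δ) (cobracket Δ x)
      + cyc3 (TensorProduct.map α (cobracket Δ) (cobracket Δ x))
      + cyc3 (cyc3 (TensorProduct.map α (cobracket Δ) (cobracket Δ x))) = 0 := by
  have hmap (t : A ⊗[k] A) : TensorProduct.map α (cobracket Δ) t
      = TensorProduct.map α Δ t - LinearMap.lTensor A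
          (TensorProduct.comm k A A).toLinearMap (TensorProduct.map α Δ t) := by
    induction t with
    | zero => simp
    | tmul u v => simp [cobracket, tmul_sub]
    | add s t hs ht =>
      simp only [map_add, hs, ht]
      abel
  have hcomm : TensorProduct.map α Δ (TensorProduct.comm k A A (Δ x))
      = TensorProduct.comm k (A ⊗[k] A) A
          ((TensorProduct.assoc k A A A).symm (TensorProduct.map α Δ (Δ x))) := by
    rw [h.2, LinearEquiv.symm_apply_apply, TensorProduct.map_comm]
  refine cyclic_sum_eq_zero (TensorProduct.map α Δ (Δ x)) _ ?_
  rw [← hcomm, ← hmap, ← hmap, ← map_sub]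
  rfl

/-- a coboundary infinitesimal Hom-bialgebra with anti-symmetric `r`
yields a coboundary Hom-Lie bialgebra via the (co)commutator (co)bracket; in
particular `δ(a) = ad_a(r)` and the balanceator vanishes. -/
theorem stmt18 [CharZero k]
    (μ : A ⊗[k] A →ₗ[k] A) (Δ : A →ₗ[k] A ⊗[k] A) (α : A →ₗ[k] A) (r : A ⊗[k] A)
    (h : IsCoboundary μ Δ α r)
    (hr : TensorProduct.comm k A A r = - r) :
    IsHomLieBialgebra (commBracket μ) (cobracket Δ) α ∧
    TensorProduct.map α α r = r ∧
    (∀ a : A, cobracket Δ a = adMap (commBracket μ) α a r) ∧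
    (∀ x y : A, balanceator μ Δ α x y = 0) := by
  obtain ⟨⟨hA, hC, -⟩, hinv, hΔ⟩ := h
  have hskew (x y : A) : commBracket μ x y = - commBracket μ y x := by simp
  have had (a : A) : cobracket Δ a = adMap (commBracket μ) α a r := by
    rw [← starBracket_add_comm, hr, map_neg, map_neg, ← hΔ, ← sub_eq_add_neg]
    rfl
  refine ⟨⟨hskew, commBracket_map hA, commBracket_jacobi hA, cobracket_map hC,
    comm_cobracket Δ, cobracket_coJacobi hC, fun x y => ?_⟩, hinv, had, fun x y => ?_⟩
  · rw [had, had, had, adMap_commutator hskew (commBracket_map hA) (commBracket_jacobi hA),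
      hinv]
  · have hb := dotBracket2_comm_starBracket hA x y r
    rw [hr, map_neg, map_neg, map_neg, ← hΔ, ← hΔ] at hb
    rw [balanceator, ← hb, add_neg_cancel]

end
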